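/- Let (Ω, μ) be a finite probability space, let n ≥ 2 be a natural number, and let ℐ = (Y_1, …, Y_D) be a family of random variables on Ω with nonempty finite codomains. Let S ⊆ S' ⊆ {1,…,D} be nonempty subsets such that H(Y_k) ≤ min_{i∈S} H(Y_i) for every k ∈ S'∖S, and assume W̄(𝒳_S) > 0 and W̄(𝒳_{S'}) > 0. Then ŵ(S') − t̄̄₀(S', n) ≤ 1 − t̄̄₀(S, n); that is, the trivial bounding function w̄₀̄̄mon(S) = 1 − t̄̄₀(S, n) is an admissible bound for the reliable normalized total correlation ŵ₀̄̄ = ŵ − t̄̄₀ over all low-entropy extensions of S. -/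

import Mathlib

open Real BigOperators
open scoped Classical

/-- The distribution of a random variable `X : Ω → A` under the pmf `μ`. -/
noncomputable def prob {Ω : Type} [Fintype Ω] (μ : Ω → ℝ) {A : Type} [DecidableEq A]
    (X : Ω → A) (a : A) : ℝ :=
  ∑ ω ∈ Finset.univ.filter (fun ω => X ω = a), μ ω

/-- Shannon entropy (natural logarithm, `0 · log 0 = 0`) of a random variable. -/
noncomputable def entropy {Ω : Type} [Fintype Ω] (μ : Ω → ℝ) {A : Type} [Fintype A]
    [DecidableEq A] (X : Ω → A) : ℝ :=
  -∑ a : A, prob μ X a * Real.log (prob μ X a)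

section Subfamily

variable {Ω : Type} [Fintype Ω] {D : ℕ} {A : Fin D → Type}
  [∀ i, Fintype (A i)] [∀ i, DecidableEq (A i)]

/-- Total correlation `W(𝒳_S)` of the subfamily `(Y_i)_{i∈S}`:
`Σ_{i∈S} H(Y_i) − H((Y_i)_{i∈S})`, where the joint entropy is that of the tuple-valued
random variable `ω ↦ (Y_i ω)_{i∈S}`. -/
noncomputable def subW (μ : Ω → ℝ) (Y : ∀ i, Ω → A i) (S : Finset (Fin D)) : ℝ :=
  (∑ i ∈ S, entropy μ (Y i)) -
    entropy μ (fun ω => (fun i : {x // x ∈ S} => Y i.1 ω))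

/-- `W̄(𝒳_S) = Σ_{i∈S} H(Y_i) − max_{i∈S} H(Y_i)`. -/
noncomputable def subWbar (μ : Ω → ℝ) (Y : ∀ i, Ω → A i) (S : Finset (Fin D)) : ℝ :=
  (∑ i ∈ S, entropy μ (Y i)) - ⨆ i : {x // x ∈ S}, entropy μ (Y i.1)

/-- The (plug-in) normalized total correlation `ŵ(S) = W(𝒳_S)/W̄(𝒳_S)`. -/
noncomputable def what (μ : Ω → ℝ) (Y : ∀ i, Ω → A i) (S : Finset (Fin D)) : ℝ :=
  subW μ Y S / subWbar μ Y S

/-- The refinement elements of `S`: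
`R_S = {k ∉ S : H(Y_k) ≤ min_{i∈S} H(Y_i)}`. -/
noncomputable def RS (μ : Ω → ℝ) (Y : ∀ i, Ω → A i) (S : Finset (Fin D)) :
    Finset (Fin D) :=
  Finset.univ.filter (fun k => k ∉ S ∧ ∀ i ∈ S, entropy μ (Y k) ≤ entropy μ (Y i))

/-- The bound `w̄(S) = (W(𝒳_S) + Σ_{k∈R_S} H(Y_k)) / (W̄(𝒳_S) + Σ_{k∈R_S} H(Y_k))`. -/
noncomputable def wbarRef (μ : Ω → ℝ) (Y : ∀ i, Ω → A i) (S : Finset (Fin D)) : ℝ :=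
  (subW μ Y S + ∑ k ∈ RS μ Y S, entropy μ (Y k)) /
    (subWbar μ Y S + ∑ k ∈ RS μ Y S, entropy μ (Y k))

end Subfamily

/-- The numerator of the correction term `t̄̄₀` for a family of `k` variables with domain
sizes `e : Fin k → ℕ` and sample size `n`:
`max_{σ ∈ S_k} Σ_{i=2}^k log((n + Π_{j=1}^i e_{σ(j)})/(n − 1))`
(`0`-indexed: sum over `i ≠ 0`, prefix product over `j ≤ i`). -/
noncomputable def tbbNum (n k : ℕ) (e : Fin k → ℕ) : ℝ :=
  ⨆ σ : Equiv.Perm (Fin k),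
    ∑ i ∈ Finset.univ.filter (fun i : Fin k => i.val ≠ 0),
      Real.log (((n : ℝ) +
          ∏ j ∈ Finset.univ.filter (fun j : Fin k => j ≤ i), (e (σ j) : ℝ)) /
        ((n : ℝ) - 1))

/-- The correction term `t̄̄₀(S, n) = t̄̄₀(𝒳_S, n)` of the subfamily `(Y_i)_{i∈S}`:
the permutation-model correction computed from the domain sizes of the variables in `S`
(enumerated via `S ≃ Fin S.card`), divided by `W̄(𝒳_S)`. -/
noncomputable def tbb0S {Ω : Type} [Fintype Ω] {D : ℕ} {A : Fin D → Type}
    [∀ i, Fintype (A i)] [∀ i, DecidableEq (A i)]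
    (μ : Ω → ℝ) (Y : ∀ i, Ω → A i) (n : ℕ) (S : Finset (Fin D)) : ℝ :=
  tbbNum n S.card (fun i => Fintype.card (A ((S.equivFin.symm i) : Fin D))) /
    subWbar μ Y S

/-- If `f` takes values on `t \ s` dominating its values on `s ⊆ t`, then its average over `t` is
at least its average over `s` (with denominators cleared). -/
lemma card_mul_sum_le_card_mul_sum_of_subset {ι : Type*} {s t : Finset ι} (hst : s ⊆ t)
    (f : ι → ℝ) (h : ∀ i ∈ t, i ∉ s → ∀ j ∈ s, f j ≤ f i) :
    (t.card : ℝ) * ∑ i ∈ s, f i ≤ (s.card : ℝ) * ∑ i ∈ t, f i := by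
  have hsum : ∑ i ∈ t \ s, f i + ∑ i ∈ s, f i = ∑ i ∈ t, f i := Finset.sum_sdiff hst
  have hcard : ((t \ s).card : ℝ) + s.card = t.card := by
    exact_mod_cast Finset.card_sdiff_add_card_eq_card hst
  have hle : ∑ i ∈ t \ s, ∑ j ∈ s, f j ≤ ∑ i ∈ t \ s, ∑ _j ∈ s, f i := by
    refine Finset.sum_le_sum fun i hi => Finset.sum_le_sum fun j hj => ?_
    rw [Finset.mem_sdiff] at hi
    exact h i hi.1 hi.2 j hj
  simp only [Finset.sum_const, nsmul_eq_mul, ← Finset.mul_sum] at hle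
  rw [← hsum, ← hcard]
  linarith

/-- Entropy does not increase under a deterministic map. -/
lemma entropy_comp_le {Ω : Type} [Fintype Ω] {μ : Ω → ℝ} (hμ0 : ∀ ω, 0 ≤ μ ω)
    {A B : Type} [Fintype A] [DecidableEq A] [Fintype B] [DecidableEq B]
    (X : Ω → A) (f : A → B) :
    entropy μ (fun ω => f (X ω)) ≤ entropy μ X := by
  have hfib : ∀ b, prob μ (fun ω => f (X ω)) b =
      ∑ a ∈ Finset.univ.filter (fun a => f a = b), prob μ X a := by
    intro b
    unfold prob
    rw [← Finset.sum_fiberwise_of_maps_to (s := Finset.univ.filter (fun ω => f (X ω) = b))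
      (t := Finset.univ.filter (fun a => f a = b)) (g := X) (by simp)]
    refine Finset.sum_congr rfl fun a ha => Finset.sum_congr ?_ fun _ _ => rfl
    rw [Finset.mem_filter] at ha
    ext ω
    simp only [Finset.mem_filter, Finset.mem_univ, true_and, and_iff_right_iff_imp]
    rintro rfl
    exact ha.2
  have hp : ∀ a, 0 ≤ prob μ X a := fun a => Finset.sum_nonneg fun ω _ => hμ0 ω
  unfold entropy
  rw [neg_le_neg_iff, ← Finset.sum_fiberwise Finset.univ f]
  refine Finset.sum_le_sum fun b _ => ?_
  nth_rewrite 1 [hfib b]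
  rw [Finset.sum_mul]
  refine Finset.sum_le_sum fun a ha => ?_
  rcases (hp a).eq_or_lt with h0 | hpos
  · simp [← h0]
  · refine mul_le_mul_of_nonneg_left (Real.log_le_log hpos ?_) hpos.le
    rw [hfib b]
    exact Finset.single_le_sum (f := prob μ X) (fun a _ => hp a) ha

/-- An injection of `Fin k` into `Fin k'` extends to a permutation of `Fin k'`. -/
lemma exists_perm_castLE_eq {k k' : ℕ} (hk : k ≤ k') (g : Fin k → Fin k')
    (hg : Function.Injective g) :
    ∃ τ : Equiv.Perm (Fin k'), ∀ i, τ (Fin.castLE hk i) = g i := by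
  let φ : {x // x ∈ Set.range (Fin.castLE hk)} ≃ {x // x ∈ Set.range g} :=
    (Equiv.ofInjective _ (Fin.castLE_injective hk)).symm.trans (Equiv.ofInjective g hg)
  refine ⟨φ.extendSubtype, fun i => ?_⟩
  rw [Equiv.extendSubtype_apply_of_mem φ _ (Set.mem_range_self i)]
  have hi : (Equiv.ofInjective _ (Fin.castLE_injective hk)).symm
      ⟨Fin.castLE hk i, Set.mem_range_self i⟩ = i :=
    Equiv.ofInjective_symm_apply (Fin.castLE_injective hk) i
  change ((Equiv.ofInjective g hg) ((Equiv.ofInjective _ (Fin.castLE_injective hk)).symm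
      ⟨Fin.castLE hk i, Set.mem_range_self i⟩) : Fin k') = g i
  rw [hi]
  rfl

lemma card_filter_val_ne_zero (k : ℕ) :
    (Finset.univ.filter (fun i : Fin k => i.val ≠ 0)).card = k - 1 := by
  cases k with
  | zero => rfl
  | succ m =>
    have h : Finset.univ.filter (fun i : Fin (m + 1) => i.val ≠ 0) = Finset.univ.erase 0 := by
      ext i
      simp only [Finset.mem_filter, Finset.mem_univ, true_and, Finset.mem_erase, and_true, ne_eq,
        Fin.ext_iff, Fin.val_zero]
    rw [h, Finset.card_erase_of_mem (Finset.mem_univ _), Finset.card_univ, Fintype.card_fin]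

lemma tbbNum_nonneg {n : ℕ} (hn : 2 ≤ n) (k : ℕ) (e : Fin k → ℕ) : 0 ≤ tbbNum n k e := by
  refine Real.iSup_nonneg fun σ => Finset.sum_nonneg fun i _ => Real.log_nonneg ?_
  have hn' : (2 : ℝ) ≤ n := by exact_mod_cast hn
  rw [le_div_iff₀ (by linarith)]
  have hprod : (0 : ℝ) ≤ ∏ j ∈ Finset.univ.filter (fun j : Fin k => j ≤ i), (e (σ j) : ℝ) :=
    Finset.prod_nonneg fun j _ => Nat.cast_nonneg _
  linarith

/-- Per summand, the correction numerator does not decrease when the family is extended. -/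
lemma mul_tbbNum_le_mul_tbbNum {n : ℕ} (hn : 2 ≤ n) {k k' : ℕ} (hk : k ≤ k') {e : Fin k → ℕ}
    {e' : Fin k' → ℕ} (he' : ∀ i, 1 ≤ e' i) (g : Fin k → Fin k') (hg : Function.Injective g)
    (hge : ∀ i, e' (g i) = e i) :
    ((k' - 1 : ℕ) : ℝ) * tbbNum n k e ≤ ((k - 1 : ℕ) : ℝ) * tbbNum n k' e' := by
  have hn' : (2 : ℝ) ≤ n := by exact_mod_cast hn
  unfold tbbNum
  rw [Real.mul_iSup_of_nonneg (Nat.cast_nonneg _)]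
  refine ciSup_le fun σ => ?_
  obtain ⟨τ, hτ⟩ := exists_perm_castLE_eq hk (g ∘ σ) (hg.comp σ.injective)
  refine le_trans ?_ (mul_le_mul_of_nonneg_left
    (le_ciSup (Set.finite_range _).bddAbove τ) (Nat.cast_nonneg _))
  set a : Fin k' → ℝ := fun i => Real.log (((n : ℝ) +
    ∏ j ∈ Finset.univ.filter (fun j : Fin k' => j ≤ i), (e' (τ j) : ℝ)) / ((n : ℝ) - 1))
  have hprefix : ∀ i : Fin k, ∏ j ∈ Finset.univ.filter (fun j : Fin k => j ≤ i), (e (σ j) : ℝ) =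
      ∏ j ∈ Finset.univ.filter (fun j : Fin k' => j ≤ Fin.castLE hk i), (e' (τ j) : ℝ) := by
    intro i
    have hmap : Finset.univ.filter (fun j : Fin k' => j ≤ Fin.castLE hk i) =
        (Finset.univ.filter (fun j : Fin k => j ≤ i)).map (Fin.castLEEmb hk) := by
      ext j
      simp only [Finset.mem_filter, Finset.mem_univ, true_and, Finset.mem_map, Fin.castLEEmb_apply]
      constructor
      · intro hj
        exact ⟨⟨j, lt_of_le_of_lt (Fin.le_def.1 hj) i.2⟩, hj, rfl⟩
      · rintro ⟨l, hl, rfl⟩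
        exact hl
    rw [hmap, Finset.prod_map]
    refine Finset.prod_congr rfl fun j _ => ?_
    rw [Fin.castLEEmb_apply, hτ, Function.comp_apply, hge]
  have hmono : Monotone a := by
    intro i j hij
    have hprod : ∏ l ∈ Finset.univ.filter (fun l : Fin k' => l ≤ i), (e' (τ l) : ℝ) ≤
        ∏ l ∈ Finset.univ.filter (fun l : Fin k' => l ≤ j), (e' (τ l) : ℝ) := by
      refine Finset.prod_le_prod_of_subset_of_one_le ?_ (fun l _ => Nat.cast_nonneg _)
        (fun l _ _ => by exact_mod_cast he' (τ l))
      intro l hl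
      simp only [Finset.mem_filter, Finset.mem_univ, true_and] at hl ⊢
      exact hl.trans hij
    have hpos : (0 : ℝ) ≤ ∏ l ∈ Finset.univ.filter (fun l : Fin k' => l ≤ i), (e' (τ l) : ℝ) :=
      Finset.prod_nonneg fun l _ => Nat.cast_nonneg _
    have hn1 : (0 : ℝ) < (n : ℝ) - 1 := by linarith
    refine Real.log_le_log (div_pos (by linarith) hn1) ?_
    gcongr
  have hsub : (Finset.univ.filter (fun i : Fin k => i.val ≠ 0)).map (Fin.castLEEmb hk) ⊆
      Finset.univ.filter (fun i : Fin k' => i.val ≠ 0) := by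
    intro i hi
    simp only [Finset.mem_filter, Finset.mem_univ, true_and, Finset.mem_map] at hi ⊢
    obtain ⟨l, hl, rfl⟩ := hi
    exact hl
  have key := card_mul_sum_le_card_mul_sum_of_subset hsub a (by
    intro i hi his j hj
    simp only [Finset.mem_filter, Finset.mem_univ, true_and, Finset.mem_map] at hi his hj
    obtain ⟨l, -, rfl⟩ := hj
    refine hmono (Fin.le_def.2 ?_)
    by_contra! hlt
    exact his ⟨⟨i, lt_trans hlt l.2⟩, hi, rfl⟩)
  rw [Finset.card_map, card_filter_val_ne_zero, card_filter_val_ne_zero, Finset.sum_map] at key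
  simp only [hprefix]
  exact key

section Subfamily

variable {Ω : Type} [Fintype Ω] {D : ℕ} {A : Fin D → Type}
  [∀ i, Fintype (A i)] [∀ i, DecidableEq (A i)]

lemma subW_le_subWbar {μ : Ω → ℝ} (hμ0 : ∀ ω, 0 ≤ μ ω) (Y : ∀ i, Ω → A i) {S : Finset (Fin D)}
    (hS : S.Nonempty) : subW μ Y S ≤ subWbar μ Y S := by
  have : Nonempty {x // x ∈ S} := hS.to_subtype
  refine sub_le_sub_left (ciSup_le fun i => ?_) _
  exact entropy_comp_le hμ0 (fun ω => (fun i : {x // x ∈ S} => Y i.1 ω)) (fun v => v i)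

lemma subWbar_le_sum_erase (μ : Ω → ℝ) (Y : ∀ i, Ω → A i) {S : Finset (Fin D)} {m : Fin D}
    (hm : m ∈ S) : subWbar μ Y S ≤ ∑ i ∈ S.erase m, entropy μ (Y i) := by
  have hle : entropy μ (Y m) ≤ ⨆ i : {x // x ∈ S}, entropy μ (Y i.1) :=
    le_ciSup (f := fun i : {x // x ∈ S} => entropy μ (Y i.1))
      (Set.finite_range _).bddAbove ⟨m, hm⟩
  have hsum := Finset.add_sum_erase S (fun i => entropy μ (Y i)) hm
  unfold subWbar
  linarith

lemma exists_subWbar_eq_sum_erase (μ : Ω → ℝ) (Y : ∀ i, Ω → A i) {S : Finset (Fin D)}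
    (hS : S.Nonempty) : ∃ m ∈ S, subWbar μ Y S = ∑ i ∈ S.erase m, entropy μ (Y i) := by
  have : Nonempty {x // x ∈ S} := hS.to_subtype
  obtain ⟨m, hm⟩ := exists_eq_ciSup_of_finite (f := fun i : {x // x ∈ S} => entropy μ (Y i.1))
  refine ⟨m, m.2, ?_⟩
  have hsum := Finset.add_sum_erase S (fun i => entropy μ (Y i)) m.2
  unfold subWbar
  rw [← hm]
  linarith

/-- Per summand, `W̄` does not increase under low-entropy extensions. -/
lemma mul_subWbar_le_mul_subWbar (μ : Ω → ℝ) (Y : ∀ i, Ω → A i) {S S' : Finset (Fin D)}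
    (hS : S.Nonempty) (hSS' : S ⊆ S')
    (hlow : ∀ k ∈ S' \ S, ∀ i ∈ S, entropy μ (Y k) ≤ entropy μ (Y i)) :
    ((S.card - 1 : ℕ) : ℝ) * subWbar μ Y S' ≤ ((S'.card - 1 : ℕ) : ℝ) * subWbar μ Y S := by
  obtain ⟨m, hm, hWm⟩ := exists_subWbar_eq_sum_erase μ Y hS
  have key := card_mul_sum_le_card_mul_sum_of_subset (Finset.erase_subset_erase m hSS')
    (fun i => -entropy μ (Y i)) (by
      intro i hi his j hj
      rw [Finset.mem_erase] at hi his hj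
      exact neg_le_neg (hlow i (Finset.mem_sdiff.2 ⟨hi.2, fun h => his ⟨hi.1, h⟩⟩) j hj.2))
  rw [Finset.card_erase_of_mem hm, Finset.card_erase_of_mem (hSS' hm), Finset.sum_neg_distrib,
    Finset.sum_neg_distrib, mul_neg, mul_neg, neg_le_neg_iff] at key
  rw [hWm]
  exact (mul_le_mul_of_nonneg_left (subWbar_le_sum_erase μ Y (hSS' hm))
    (Nat.cast_nonneg _)).trans key

lemma one_lt_card_of_subWbar_pos {μ : Ω → ℝ} {Y : ∀ i, Ω → A i} {S : Finset (Fin D)}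
    (hS : S.Nonempty) (hW : 0 < subWbar μ Y S) : 1 < S.card := by
  obtain ⟨m, hm, hWm⟩ := exists_subWbar_eq_sum_erase μ Y hS
  by_contra! hcard
  have hempty : S.erase m = ∅ := by
    rw [← Finset.card_eq_zero, Finset.card_erase_of_mem hm]
    omega
  rw [hWm, hempty, Finset.sum_empty] at hW
  exact hW.false

/-- The correction term is monotone under low-entropy extensions. -/
lemma tbb0S_le_tbb0S [∀ i, Nonempty (A i)] (μ : Ω → ℝ) {n : ℕ} (hn : 2 ≤ n) (Y : ∀ i, Ω → A i)
    {S S' : Finset (Fin D)} (hS : S.Nonempty) (hSS' : S ⊆ S')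
    (hlow : ∀ k ∈ S' \ S, ∀ i ∈ S, entropy μ (Y k) ≤ entropy μ (Y i))
    (hWS : 0 < subWbar μ Y S) (hWS' : 0 < subWbar μ Y S') :
    tbb0S μ Y n S ≤ tbb0S μ Y n S' := by
  have hnum := mul_tbbNum_le_mul_tbbNum hn (Finset.card_le_card hSS')
    (e := fun i => Fintype.card (A ((S.equivFin.symm i) : Fin D)))
    (e' := fun i => Fintype.card (A ((S'.equivFin.symm i) : Fin D)))
    (fun i => Fintype.card_pos)
    (fun i => S'.equivFin ⟨S.equivFin.symm i, hSS' (S.equivFin.symm i).2⟩)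
    (by
      intro i j hij
      have h := congrArg Subtype.val (S'.equivFin.injective hij)
      exact S.equivFin.symm.injective (Subtype.ext h))
    (fun i => by simp)
  have hden := mul_subWbar_le_mul_subWbar μ Y hS hSS' hlow
  have hcard : (0 : ℝ) < ((S.card - 1 : ℕ) : ℝ) := by
    have := one_lt_card_of_subWbar_pos hS hWS
    exact_mod_cast Nat.sub_pos_of_lt this
  have hnonneg := tbbNum_nonneg hn S.card
    (fun i => Fintype.card (A ((S.equivFin.symm i) : Fin D)))
  unfold tbb0S
  rw [div_le_div_iff₀ hWS hWS']
  refine le_of_mul_le_mul_left ?_ hcard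
  have h₁ := mul_le_mul_of_nonneg_left hden hnonneg
  have h₂ := mul_le_mul_of_nonneg_right hnum hWS.le
  linarith

end Subfamily

/-- For nonempty `S ⊆ S' ⊆ {1,…,D}` with `S'` a low-entropy extension of
`S`, `W̄(𝒳_S) > 0`, `W̄(𝒳_{S'}) > 0`, and sample size `n ≥ 2`:
`ŵ(S') − t̄̄₀(S', n) ≤ 1 − t̄̄₀(S, n)`, i.e. the trivial bounding function
`w̄₀̄̄mon(S) = 1 − t̄̄₀(S, n)` is admissible for `ŵ₀̄̄ = ŵ − t̄̄₀`. -/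
theorem trivial_bound_admissible {Ω : Type} [Fintype Ω] [Nonempty Ω]
    (μ : Ω → ℝ) (hμ0 : ∀ ω, 0 ≤ μ ω) (hμ1 : ∑ ω, μ ω = 1)
    (n : ℕ) (hn : 2 ≤ n)
    {D : ℕ} {A : Fin D → Type}
    [∀ i, Fintype (A i)] [∀ i, DecidableEq (A i)] [∀ i, Nonempty (A i)]
    (Y : ∀ i, Ω → A i) (S S' : Finset (Fin D))
    (hS : S.Nonempty) (hS' : S'.Nonempty) (hSS' : S ⊆ S')
    (hlow : ∀ k ∈ S' \ S, ∀ i ∈ S, entropy μ (Y k) ≤ entropy μ (Y i))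
    (hWS : 0 < subWbar μ Y S) (hWS' : 0 < subWbar μ Y S') :
    what μ Y S' - tbb0S μ Y n S' ≤ 1 - tbb0S μ Y n S := by
  have hw : what μ Y S' ≤ 1 := (div_le_one hWS').2 (subW_le_subWbar hμ0 Y hS')
  have ht := tbb0S_le_tbb0S μ hn Y hS hSS' hlow hWS hWS'
  linarith
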